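/- For all x, y in W, the set {uy : u ∈ W, u ≤ x} has a unique minimal element in Bruhat order, denoted x ▷ y, and there exists x₁ ∈ W with x₁ ≤ x, x ▷ y = x₁ y, and l(x ▷ y) = l(y) − l(x₁). -/

import Mathlib

/-! Common setup: a finite Coxeter system, Bruhat order, and the sets
`{u * y : u ≤ x}` and `{x * v : v ≤ y}` used to characterize the
Demazure product `∗` and the operations `▷`, `◁`. -/

/-- The Bruhat order on a Coxeter group: the reflexive-transitive closure of
the relation `u → u * t`, where `t` is a reflection and right multiplication
by `t` increases length. -/
def CoxeterSystem.bruhatLE {B W : Type*} [Group W] {M : CoxeterMatrix B}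
    (cs : CoxeterSystem M W) : W → W → Prop :=
  Relation.ReflTransGen
    (fun u v => ∃ t, cs.IsReflection t ∧ v = u * t ∧ cs.length u < cs.length v)

/-- The set `{u * y : u ∈ W, u ≤ x}`. -/
def CoxeterSystem.lset {B W : Type*} [Group W] {M : CoxeterMatrix B}
    (cs : CoxeterSystem M W) (x y : W) : Set W :=
  {z | ∃ u, cs.bruhatLE u x ∧ z = u * y}

/-- The set `{x * v : v ∈ W, v ≤ y}`. -/
def CoxeterSystem.rset {B W : Type*} [Group W] {M : CoxeterMatrix B}
    (cs : CoxeterSystem M W) (x y : W) : Set W :=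
  {z | ∃ v, cs.bruhatLE v y ∧ z = x * v}

namespace CoxeterSystem

open scoped Classical in
/-- The permutation-like action of a generator on `W × ZMod 2`: conjugation on the first factor,
with a flip of the second factor exactly at the generator itself. -/
noncomputable def simpleFlip {B W : Type*} [Group W] {M : CoxeterMatrix B}
    (cs : CoxeterSystem M W) (i : B) : Function.End (W × ZMod 2) :=
  fun p => (cs.simple i * p.1 * cs.simple i, p.2 + if p.1 = cs.simple i then 1 else 0)

section

variable {B W : Type*} [Group W] {M : CoxeterMatrix B} (cs : CoxeterSystem M W)

open scoped Classical in
theorem simpleFlip_mul_pow_apply (i j : B) (n : ℕ) (p : W × ZMod 2) :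
    ((cs.simpleFlip i * cs.simpleFlip j) ^ n) p =
      ((cs.simple i * cs.simple j) ^ n * p.1 * ((cs.simple i * cs.simple j) ^ n)⁻¹,
        p.2 + ∑ k ∈ Finset.range (2 * n),
          if p.1 = cs.simple j * (cs.simple i * cs.simple j) ^ k then 1 else 0) := by
  induction n with
  | zero =>
    rw [pow_zero, Function.End.one_def]
    simp
  | succ n ih =>
    set a := cs.simple i with ha
    set b := cs.simple j with hb
    have hbb : b * b = 1 := cs.simple_mul_simple_self j
    have hai : a⁻¹ = a := cs.inv_simple i
    have hbi : b⁻¹ = b := cs.inv_simple j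
    have hconj : ∀ k : ℕ, ((a * b) ^ k)⁻¹ * b = b * (a * b) ^ k := by
      intro k
      have h : b * (a * b) ^ k * b⁻¹ = (b * (a * b) * b⁻¹) ^ k := conj_pow.symm
      have h' : b * (a * b) * b⁻¹ = (a * b)⁻¹ := by
        rw [mul_inv_rev, hai, hbi]
        simp only [mul_assoc, hbb, mul_one]
      rw [h', inv_pow] at h
      rw [← h]; simp [mul_assoc]
    have e1 : ((a * b) ^ n * p.1 * ((a * b) ^ n)⁻¹ = b) ↔ p.1 = b * (a * b) ^ (2 * n) := by
      rw [two_mul, pow_add, ← mul_assoc, ← hconj, mul_inv_eq_iff_eq_mul, mul_assoc, eq_inv_mul_iff_mul_eq]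
    have e2 : (b * ((a * b) ^ n * p.1 * ((a * b) ^ n)⁻¹) * b = a) ↔
        p.1 = b * (a * b) ^ (2 * n + 1) := by
      have : b * (a * b) ^ (2 * n + 1) = ((a * b) ^ n)⁻¹ * (b * a * b) * (a * b) ^ n := by
        rw [show 2 * n + 1 = n + (1 + n) by ring, pow_add, pow_add, ← mul_assoc, ← hconj, pow_one]
        simp only [mul_assoc]
      rw [this]
      generalize (a * b) ^ n = c
      constructor
      · intro h
        rw [← h]
        simp only [mul_assoc, hbb, mul_one, inv_mul_cancel]
        rw [← mul_assoc b b, hbb, one_mul, inv_mul_cancel_left]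
      · intro h
        rw [h]
        simp only [mul_assoc, hbb, mul_one, mul_inv_cancel, mul_inv_cancel_left]
        rw [← mul_assoc b b, hbb, one_mul]
    have hstep : ((cs.simpleFlip i * cs.simpleFlip j) ^ (n + 1)) p =
        cs.simpleFlip i (cs.simpleFlip j (((cs.simpleFlip i * cs.simpleFlip j) ^ n) p)) := by
      rw [pow_succ']; rfl
    rw [hstep, ih]
    simp only [simpleFlip, ← ha, ← hb, e1, e2]
    rw [show 2 * (n + 1) = 2 * n + 1 + 1 by ring, Finset.sum_range_succ, Finset.sum_range_succ]
    ext
    · simp [pow_succ', mul_assoc, hai, hbi]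
    · simp [add_assoc]

theorem isLiftable_simpleFlip : M.IsLiftable cs.simpleFlip := by
  classical
  intro i j
  funext p
  rw [simpleFlip_mul_pow_apply, cs.simple_mul_simple_pow, two_mul, Finset.sum_range_add]
  simp only [pow_add, cs.simple_mul_simple_pow, one_mul]
  rw [CharTwo.add_self_eq_zero, Function.End.one_def]
  simp

/-- The action of `W` on `W × ZMod 2` whose second component counts, modulo two, how often a
reflection occurs in the inversion sequence of a word. -/
noncomputable def flip : W →* Function.End (W × ZMod 2) :=
  cs.lift ⟨cs.simpleFlip, cs.isLiftable_simpleFlip⟩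

theorem flip_simple (i : B) : cs.flip (cs.simple i) = cs.simpleFlip i :=
  cs.lift_apply_simple cs.isLiftable_simpleFlip i

/-- The inversion cocycle: the parity of the occurrences of `t` in the right inversion sequence
of any word for `w`. -/
noncomputable def invParity (w t : W) : ZMod 2 := (cs.flip w (t, 0)).2

theorem flip_apply (w : W) (p : W × ZMod 2) :
    cs.flip w p = (w * p.1 * w⁻¹, p.2 + cs.invParity w p.1) := by
  induction w using cs.simple_induction_left generalizing p with
  | one =>
    rw [invParity, map_one, Function.End.one_def]
    simp
  | mul_simple_left w i ih =>
    have h : ∀ q, cs.flip (cs.simple i * w) q = cs.simpleFlip i (cs.flip w q) := by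
      intro q
      rw [map_mul, flip_simple]; rfl
    rw [invParity, h, h, ih, ih (p.1, 0)]
    simp [simpleFlip, mul_assoc, add_assoc]

@[simp]
theorem invParity_one (t : W) : cs.invParity 1 t = 0 := by
  rw [invParity, map_one]
  rfl

theorem invParity_mul (u w t : W) :
    cs.invParity (u * w) t = cs.invParity w t + cs.invParity u (w * t * w⁻¹) := by
  have h : cs.flip (u * w) (t, 0) = cs.flip u (cs.flip w (t, 0)) := by
    rw [map_mul]; rfl
  rw [invParity, h, flip_apply, flip_apply]
  simp

open scoped Classical in
theorem invParity_simple (i : B) (t : W) :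
    cs.invParity (cs.simple i) t = if t = cs.simple i then 1 else 0 := by
  simp [invParity, flip_simple, simpleFlip]

theorem IsReflection.invParity_self {t : W} (ht : cs.IsReflection t) :
    cs.invParity t t = 1 := by
  obtain ⟨w, i, rfl⟩ := ht
  have h := cs.invParity_mul w⁻¹ w (cs.simple i)
  rw [inv_mul_cancel, invParity_one] at h
  rw [invParity_mul, invParity_mul, invParity_simple]
  simp only [mul_assoc, inv_inv, inv_mul_cancel_left, inv_mul_cancel, mul_one, one_mul,
    cs.inv_simple, cs.simple_mul_simple_self, if_true] at h ⊢
  linear_combination -h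

theorem mem_rightInvSeq_of_invParity_ne_zero (ω : List B) (t : W)
    (h : cs.invParity (cs.wordProd ω) t ≠ 0) : t ∈ cs.rightInvSeq ω := by
  induction ω with
  | nil => simp at h
  | cons i ω ih =>
    rw [wordProd_cons, invParity_mul, invParity_simple] at h
    rw [rightInvSeq, List.mem_cons]
    by_cases ht : cs.wordProd ω * t * (cs.wordProd ω)⁻¹ = cs.simple i
    · left
      rw [← ht]; group
    · right
      exact ih (by simpa [ht] using h)

theorem length_mul_lt_of_invParity_ne_zero {w t : W} (h : cs.invParity w t ≠ 0) :
    cs.length (w * t) < cs.length w := by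
  obtain ⟨ω, hω, rfl⟩ := cs.exists_isReduced w
  exact (cs.isRightInversion_of_mem_rightInvSeq hω
    (cs.mem_rightInvSeq_of_invParity_ne_zero ω t h)).2

theorem IsReflection.length_lt_length_mul_iff {t : W} (ht : cs.IsReflection t) (w : W) :
    cs.length w < cs.length (w * t) ↔ cs.invParity w t = 0 := by
  constructor
  · intro h
    by_contra hne
    exact (cs.length_mul_lt_of_invParity_ne_zero hne).not_gt h
  · intro h
    have h1 : cs.invParity (w * t) t ≠ 0 := by
      rw [invParity_mul, ht.invParity_self]
      simp [h]
    simpa [mul_assoc, ht.mul_self] using cs.length_mul_lt_of_invParity_ne_zero h1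

theorem IsReflection.length_simple_mul_lt {t : W} (ht : cs.IsReflection t) {u : W} (i : B)
    (h : cs.length u < cs.length (u * t)) (hne : cs.simple i * u ≠ u * t) :
    cs.length (cs.simple i * u) < cs.length (cs.simple i * u * t) := by
  rw [ht.length_lt_length_mul_iff] at h ⊢
  rw [invParity_mul, h, invParity_simple, if_neg, add_zero]
  rintro h'
  exact hne (by rw [← h']; group)

theorem bruhatLE_refl (w : W) : cs.bruhatLE w w := Relation.ReflTransGen.refl

variable {cs} in
theorem bruhatLE.trans {u v w : W} (h : cs.bruhatLE u v) (h' : cs.bruhatLE v w) :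
    cs.bruhatLE u w := Relation.ReflTransGen.trans h h'

theorem bruhatLE_mul_of_length_lt {t u : W} (ht : cs.IsReflection t)
    (h : cs.length u < cs.length (u * t)) : cs.bruhatLE u (u * t) :=
  Relation.ReflTransGen.single ⟨t, ht, rfl, h⟩

theorem bruhatLE_simple_mul {u : W} {i : B} (h : cs.length u < cs.length (cs.simple i * u)) :
    cs.bruhatLE u (cs.simple i * u) := by
  have e : cs.simple i * u = u * (u⁻¹ * cs.simple i * u⁻¹⁻¹) := by group
  rw [e] at h ⊢
  exact cs.bruhatLE_mul_of_length_lt ((cs.isReflection_simple i).conj u⁻¹) h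

theorem bruhatLE_of_length_simple_mul_lt {u : W} {i : B}
    (h : cs.length (cs.simple i * u) < cs.length u) : cs.bruhatLE (cs.simple i * u) u := by
  simpa using cs.bruhatLE_simple_mul (u := cs.simple i * u) (i := i) (by simpa using h)

/-- The shorter of `w` and `s i * w`. -/
noncomputable def leftMin (i : B) (w : W) : W :=
  if cs.length (cs.simple i * w) < cs.length w then cs.simple i * w else w

/-- The longer of `w` and `s i * w`. -/
noncomputable def leftMax (i : B) (w : W) : W :=
  if cs.length (cs.simple i * w) < cs.length w then w else cs.simple i * w

theorem length_lt_simple_mul_of_not_lt {w : W} {i : B}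
    (h : ¬ cs.length (cs.simple i * w) < cs.length w) :
    cs.length w < cs.length (cs.simple i * w) :=
  lt_of_le_of_ne (not_lt.mp h) (cs.length_simple_mul_ne w i).symm

theorem leftMin_simple_mul (i : B) (w : W) :
    cs.leftMin i (cs.simple i * w) = cs.leftMin i w := by
  have := cs.length_simple_mul_ne w i
  unfold leftMin
  simp only [simple_mul_simple_cancel_left]
  split_ifs <;> first | rfl | omega

theorem leftMax_simple_mul (i : B) (w : W) :
    cs.leftMax i (cs.simple i * w) = cs.leftMax i w := by
  have := cs.length_simple_mul_ne w i
  unfold leftMax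
  simp only [simple_mul_simple_cancel_left]
  split_ifs <;> first | rfl | omega

theorem leftMin_bruhatLE (i : B) (w : W) : cs.bruhatLE (cs.leftMin i w) w := by
  unfold leftMin
  split_ifs with h
  · exact cs.bruhatLE_of_length_simple_mul_lt h
  · exact cs.bruhatLE_refl w

theorem bruhatLE_leftMax (i : B) (w : W) : cs.bruhatLE w (cs.leftMax i w) := by
  unfold leftMax
  split_ifs with h
  · exact cs.bruhatLE_refl w
  · exact cs.bruhatLE_simple_mul (cs.length_lt_simple_mul_of_not_lt h)

theorem leftMin_bruhatLE_simple_mul (i : B) (w : W) :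
    cs.bruhatLE (cs.leftMin i w) (cs.simple i * w) :=
  cs.leftMin_simple_mul i w ▸ cs.leftMin_bruhatLE i (cs.simple i * w)

theorem simple_mul_bruhatLE_leftMax (i : B) (w : W) :
    cs.bruhatLE (cs.simple i * w) (cs.leftMax i w) :=
  cs.leftMax_simple_mul i w ▸ cs.bruhatLE_leftMax i (cs.simple i * w)

variable {cs} in
theorem bruhatLE.leftMin_mono {u w : W} (h : cs.bruhatLE u w) (i : B) :
    cs.bruhatLE (cs.leftMin i u) (cs.leftMin i w) := by
  induction h with
  | refl => exact cs.bruhatLE_refl _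
  | @tail v w _ hvw ih =>
    refine ih.trans ?_
    obtain ⟨t, ht, rfl, hl⟩ := hvw
    by_cases hs : cs.simple i * v = v * t
    · rw [← hs, leftMin_simple_mul]
      exact cs.bruhatLE_refl _
    · conv_rhs => unfold leftMin
      split_ifs
      · rw [← mul_assoc]
        exact (cs.leftMin_bruhatLE_simple_mul i v).trans
          (cs.bruhatLE_mul_of_length_lt ht (ht.length_simple_mul_lt cs i hl hs))
      · exact (cs.leftMin_bruhatLE i v).trans (cs.bruhatLE_mul_of_length_lt ht hl)

variable {cs} in
theorem bruhatLE.leftMax_mono {u w : W} (h : cs.bruhatLE u w) (i : B) :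
    cs.bruhatLE (cs.leftMax i u) (cs.leftMax i w) := by
  induction h with
  | refl => exact cs.bruhatLE_refl _
  | @tail v w _ hvw ih =>
    refine ih.trans ?_
    obtain ⟨t, ht, rfl, hl⟩ := hvw
    by_cases hs : cs.simple i * v = v * t
    · rw [← hs, leftMax_simple_mul]
      exact cs.bruhatLE_refl _
    · conv_lhs => unfold leftMax
      split_ifs
      · exact (cs.bruhatLE_mul_of_length_lt ht hl).trans (cs.bruhatLE_leftMax i (v * t))
      · refine (cs.bruhatLE_mul_of_length_lt ht (ht.length_simple_mul_lt cs i hl hs)).trans ?_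
        rw [mul_assoc]
        exact cs.simple_mul_bruhatLE_leftMax i (v * t)

theorem bruhatLE_one_iff {u : W} : cs.bruhatLE u 1 ↔ u = 1 := by
  constructor
  · intro h
    rcases Relation.ReflTransGen.cases_tail h with h | ⟨v, -, t, -, -, hl⟩
    · exact h.symm
    · simp at hl
  · rintro rfl
    exact cs.bruhatLE_refl 1

theorem exists_bruhatLE_lset (x y : W) :
    ∃ x₁ : W, cs.bruhatLE x₁ x ∧ (∀ z ∈ cs.lset x y, cs.bruhatLE (x₁ * y) z) ∧
      cs.length (x₁ * y) + cs.length x₁ = cs.length y := by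
  induction hn : cs.length x generalizing x with
  | zero =>
    obtain rfl := cs.length_eq_zero_iff.mp hn
    refine ⟨1, cs.bruhatLE_refl 1, ?_, by simp⟩
    rintro z ⟨u, hu, rfl⟩
    rw [cs.bruhatLE_one_iff.mp hu]
    exact cs.bruhatLE_refl _
  | succ n ih =>
    have hx : x ≠ 1 := by rintro rfl; simp at hn
    obtain ⟨i, hi⟩ := cs.exists_leftDescent_of_ne_one hx
    have hlen := cs.isLeftDescent_iff.mp hi
    have hi' : cs.length (cs.simple i * x) < cs.length x := hi
    obtain ⟨v, hv, hmin, hl⟩ := ih (cs.simple i * x) (by omega)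
    have hmin' : ∀ z ∈ cs.lset x y, cs.bruhatLE (cs.leftMin i (v * y)) z := by
      rintro z ⟨u, hu, rfl⟩
      have h := hu.leftMin_mono i
      rw [show cs.leftMin i x = cs.simple i * x from if_pos hi'] at h
      by_cases hs : cs.length (cs.simple i * u) < cs.length u
      · rw [show cs.leftMin i u = cs.simple i * u from if_pos hs] at h
        have h' := (hmin _ ⟨_, h, rfl⟩).leftMin_mono i
        rw [mul_assoc, leftMin_simple_mul] at h'
        exact h'.trans (cs.leftMin_bruhatLE i _)
      · rw [show cs.leftMin i u = u from if_neg hs] at h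
        exact (cs.leftMin_bruhatLE i _).trans (hmin _ ⟨_, h, rfl⟩)
    by_cases hs : cs.length (cs.simple i * (v * y)) < cs.length (v * y)
    · rw [show cs.leftMin i (v * y) = cs.simple i * v * y by
        rw [mul_assoc]; exact if_pos hs] at hmin'
      refine ⟨cs.simple i * v, ?_, hmin', ?_⟩
      · have h := hv.leftMax_mono i
        rw [leftMax_simple_mul, show cs.leftMax i x = x from if_pos hi'] at h
        exact (cs.simple_mul_bruhatLE_leftMax i v).trans h
      · have h1 := cs.length_simple_mul (v * y) i
        have h2 := cs.length_simple_mul v i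
        have h3 := cs.length_le_length_mul_add_left (cs.simple i * v) y
        rw [mul_assoc] at h3 ⊢
        omega
    · rw [show cs.leftMin i (v * y) = v * y from if_neg hs] at hmin'
      exact ⟨v, hv.trans (cs.bruhatLE_of_length_simple_mul_lt hi'), hmin', hl⟩

end

end CoxeterSystem

/-- For all `x y` in a finite Coxeter group `W`, the set `{u * y : u ≤ x}` has a
unique minimal element `x ▷ y` in Bruhat order, and `x ▷ y = x₁ * y` with
`x₁ ≤ x` and `l(x ▷ y) = l(y) - l(x₁)`. -/
theorem rtr_exists {B W : Type*} [Group W] [Finite W] {M : CoxeterMatrix B}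
    (cs : CoxeterSystem M W) (x y : W) :
    ∃ m : W,
      m ∈ cs.lset x y ∧
      (∀ z ∈ cs.lset x y, cs.bruhatLE m z) ∧
      (∀ m' ∈ cs.lset x y, (∀ z ∈ cs.lset x y, cs.bruhatLE z m' → z = m') → m' = m) ∧
      (∃ x₁ : W, cs.bruhatLE x₁ x ∧ m = x₁ * y ∧
        cs.length m + cs.length x₁ = cs.length y) := by
  obtain ⟨x₁, hx₁, hmin, hl⟩ := cs.exists_bruhatLE_lset x y
  have hmem : x₁ * y ∈ cs.lset x y := ⟨x₁, hx₁, rfl⟩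
  exact ⟨x₁ * y, hmem, hmin, fun m' hm' h => (h _ hmem (hmin m' hm')).symm, x₁, hx₁, rfl, hl⟩
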